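/- Let α ≥ 1 and β ≥ 1, let μ be a positive Borel measure on ℂ₊, and let n ∈ ℤ. Then 𝒞_α[μ_n] ≤ 2^{β+n(β−α)}·𝒞_β[μ_n] ≤ 2^{α+β}·𝒞_α[μ_n]; in particular 𝒞_α[μ_n] is comparable to 2^{n(β−α)}·𝒞_β[μ_n] with constants of comparison depending only on α and β. -/

import Mathlib

open MeasureTheory Set Complex Filter
open scoped ENNReal NNReal

noncomputable section

/-- The Laplace transform of `f : (0,∞) → ℂ`. -/
def laplace (f : ℝ → ℂ) (z : ℂ) : ℂ :=
  ∫ t in Ioi (0:ℝ), Complex.exp (-z * t) * f t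

/-- The Laplace transform of `f : (0,τ) → ℂ`. -/
def laplaceOn (τ : ℝ) (f : ℝ → ℂ) (z : ℂ) : ℂ :=
  ∫ t in Ioo (0:ℝ) τ, Complex.exp (-z * t) * f t

/-- The Carleson square `Q_I` over the interval `I = i[a,b]` on the imaginary axis. -/
def carlesonSquare (a b : ℝ) : Set ℂ :=
  {z : ℂ | z.im ∈ Icc a b ∧ z.re ∈ Ioo 0 (b - a)}

/-- The `α`-Carleson intensity of a measure on the right half-plane. -/
def carlesonIntensity (α : ℝ) (ν : Measure ℂ) : ℝ≥0∞ :=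
  ⨆ (a : ℝ) (b : ℝ) (_ : a < b),
    ν (carlesonSquare a b) / ENNReal.ofReal ((b - a) ^ α)

/-- The dyadic strip `S_n = {2^n ≤ Re z < 2^(n+1)}`. -/
def dyadicStrip (n : ℤ) : Set ℂ :=
  {z : ℂ | (2:ℝ) ^ n ≤ z.re ∧ z.re < (2:ℝ) ^ (n + 1)}

/-- `μ_n`, the restriction of `μ` to the dyadic strip `S_n`. -/
def stripPart (μ : Measure ℂ) (n : ℤ) : Measure ℂ := μ.restrict (dyadicStrip n)

/-- A Young function: increasing, continuous, convex on `[0,∞)`, with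
`Φ(t)/t → 0` as `t → 0⁺` and `Φ(t)/t → ∞` as `t → ∞`. -/
def YoungFunction (Φ : ℝ → ℝ) : Prop :=
  (∀ t, 0 ≤ t → 0 ≤ Φ t) ∧ MonotoneOn Φ (Ici 0) ∧ ContinuousOn Φ (Ici 0) ∧
    ConvexOn ℝ (Ici 0) Φ ∧
    Tendsto (fun t => Φ t / t) (nhdsWithin 0 (Ioi 0)) (nhds 0) ∧
    Tendsto (fun t => Φ t / t) atTop atTop

/-- The Luxemburg (Orlicz) norm of `f` on `J` w.r.t. the Young function `Φ`. -/
def luxNorm (Φ : ℝ → ℝ) (J : Set ℝ) (f : ℝ → ℂ) : ℝ≥0∞ :=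
  ⨅ (k : ℝ) (_ : 0 < k)
    (_ : (∫⁻ s in J, ENNReal.ofReal (Φ (‖f s‖ / k))) ≤ 1), ENNReal.ofReal k

/-- The complementary Young function `Φᶜ(s) = sup_{t ≥ 0} (st - Φ(t))`. -/
def youngConj (Φ : ℝ → ℝ) (s : ℝ) : ℝ :=
  sSup {u : ℝ | ∃ t : ℝ, 0 ≤ t ∧ u = s * t - Φ t}

theorem measurableSet_dyadicStrip (n : ℤ) : MeasurableSet (dyadicStrip n) :=
  (measurableSet_le measurable_const measurable_re).inter
    (measurableSet_lt measurable_re measurable_const)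

/-- Within the strip `S_n`, a Carleson square is covered by the Carleson squares over consecutive intervals of length `2^(n+1)`. -/
theorem carlesonSquare_inter_dyadicStrip_subset {a b : ℝ} (hab : a < b) (n : ℤ) :
    carlesonSquare a b ∩ dyadicStrip n ⊆
      ⋃ k ∈ Finset.range ⌈(b - a) / (2:ℝ) ^ (n + 1)⌉₊,
        carlesonSquare (a + k * (2:ℝ) ^ (n + 1)) (a + (k + 1) * (2:ℝ) ^ (n + 1)) ∩
          dyadicStrip n := by
  rintro z ⟨⟨⟨ha, hb⟩, hre, -⟩, hz⟩
  have hL : (0:ℝ) < (2:ℝ) ^ (n + 1) := by positivity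
  set L := (2:ℝ) ^ (n + 1) with hL_def
  have hx : 0 ≤ (z.im - a) / L := div_nonneg (by linarith) hL.le
  have hceil : ⌈(z.im - a) / L⌉₊ ≤ ⌈(b - a) / L⌉₊ := Nat.ceil_mono (by gcongr)
  have hpos : 0 < ⌈(b - a) / L⌉₊ := Nat.ceil_pos.2 (div_pos (by linarith) hL)
  have hle : (z.im - a) / L ≤ ⌈(z.im - a) / L⌉₊ := Nat.le_ceil _
  have hlt : (⌈(z.im - a) / L⌉₊ : ℝ) < (z.im - a) / L + 1 := Nat.ceil_lt_add_one hx
  obtain ⟨k, hk, hk₁, hk₂⟩ : ∃ k : ℕ, k < ⌈(b - a) / L⌉₊ ∧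
      (k : ℝ) ≤ (z.im - a) / L ∧ (z.im - a) / L ≤ k + 1 := by
    rcases hc : ⌈(z.im - a) / L⌉₊ with _ | k
    · rw [hc] at hle
      exact ⟨0, hpos, by simpa using hx, by push_cast at hle ⊢; linarith⟩
    · rw [hc] at hle hlt hceil
      push_cast at hle hlt
      exact ⟨k, hceil, by linarith, hle⟩
  rw [le_div_iff₀ hL] at hk₁
  rw [div_le_iff₀ hL] at hk₂
  refine mem_iUnion₂.2 ⟨k, Finset.mem_range.2 hk, ⟨⟨by linarith, by linarith⟩, hre, ?_⟩, hz⟩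
  have := hz.2
  linarith

theorem measure_carlesonSquare_le (β : ℝ) (ν : Measure ℂ) {a b : ℝ} (hab : a < b) :
    ν (carlesonSquare a b) ≤ carlesonIntensity β ν * ENNReal.ofReal ((b - a) ^ β) := by
  have hpos : 0 < (b - a) ^ β := Real.rpow_pos_of_pos (by linarith) β
  rw [← ENNReal.div_le_iff (by simpa using hpos) ENNReal.ofReal_ne_top]
  exact le_iSup_of_le a (le_iSup_of_le b (le_iSup_of_le hab le_rfl))

theorem stripPart_carlesonSquare_le (β : ℝ) (μ : Measure ℂ) (n : ℤ) {a b : ℝ} (hab : a < b) :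
    stripPart μ n (carlesonSquare a b) ≤
      ⌈(b - a) / (2:ℝ) ^ (n + 1)⌉₊ *
        (carlesonIntensity β (stripPart μ n) * ENNReal.ofReal (((2:ℝ) ^ (n + 1)) ^ β)) := by
  have hL : (0:ℝ) < (2:ℝ) ^ (n + 1) := by positivity
  calc stripPart μ n (carlesonSquare a b)
      = μ (carlesonSquare a b ∩ dyadicStrip n) :=
        Measure.restrict_apply' (measurableSet_dyadicStrip n)
    _ ≤ ∑ k ∈ Finset.range ⌈(b - a) / (2:ℝ) ^ (n + 1)⌉₊,
          μ (carlesonSquare (a + k * (2:ℝ) ^ (n + 1)) (a + (k + 1) * (2:ℝ) ^ (n + 1)) ∩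
            dyadicStrip n) :=
        (measure_mono (carlesonSquare_inter_dyadicStrip_subset hab n)).trans
          (measure_biUnion_finset_le _ _)
    _ ≤ ∑ _k ∈ Finset.range ⌈(b - a) / (2:ℝ) ^ (n + 1)⌉₊,
          carlesonIntensity β (stripPart μ n) * ENNReal.ofReal (((2:ℝ) ^ (n + 1)) ^ β) := by
        refine Finset.sum_le_sum fun k _ => ?_
        rw [← Measure.restrict_apply' (measurableSet_dyadicStrip n)]
        have h := measure_carlesonSquare_le β (stripPart μ n)
          (show a + k * (2:ℝ) ^ (n + 1) < a + (k + 1) * (2:ℝ) ^ (n + 1) by linarith)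
        rwa [show a + (k + 1) * (2:ℝ) ^ (n + 1) - (a + k * (2:ℝ) ^ (n + 1)) = (2:ℝ) ^ (n + 1) by
          ring] at h
    _ = _ := by rw [Finset.sum_const, Finset.card_range, nsmul_eq_mul]

theorem ceil_half_le {t : ℝ} (ht : 1 ≤ t) : (⌈t / 2⌉₊ : ℝ) ≤ t := by
  rcases le_total t 2 with h | h
  · have : ⌈t / 2⌉₊ ≤ 1 := Nat.ceil_le.2 (by push_cast; linarith)
    exact (Nat.cast_le.2 this).trans (by simpa using ht)
  · have := Nat.ceil_lt_add_one (show 0 ≤ t / 2 by linarith)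
    linarith

theorem ceil_mul_rpow_le {α : ℝ} (β : ℝ) (hα : 1 ≤ α) (n : ℤ) {l : ℝ} (hl : (2:ℝ) ^ n ≤ l) :
    (⌈l / (2:ℝ) ^ (n + 1)⌉₊ : ℝ) * ((2:ℝ) ^ (n + 1)) ^ β ≤
      (2:ℝ) ^ (β + (n : ℝ) * (β - α)) * l ^ α := by
  have hL : (0:ℝ) < (2:ℝ) ^ n := by positivity
  have ht : 1 ≤ l / (2:ℝ) ^ n := (one_le_div hL).2 hl
  have hceil : (⌈l / (2:ℝ) ^ (n + 1)⌉₊ : ℝ) ≤ (l / (2:ℝ) ^ n) ^ α := by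
    rw [zpow_add_one₀ two_ne_zero, ← div_div]
    exact (ceil_half_le ht).trans (Real.self_le_rpow_of_one_le ht hα)
  calc (⌈l / (2:ℝ) ^ (n + 1)⌉₊ : ℝ) * ((2:ℝ) ^ (n + 1)) ^ β
      ≤ (l / (2:ℝ) ^ n) ^ α * ((2:ℝ) ^ (n + 1)) ^ β := by gcongr
    _ = (2:ℝ) ^ (β + (n : ℝ) * (β - α)) * l ^ α := by
        rw [Real.div_rpow (hL.le.trans hl) hL.le, ← Real.rpow_intCast, ← Real.rpow_intCast,
          ← Real.rpow_mul zero_le_two, ← Real.rpow_mul zero_le_two, div_mul_eq_mul_div,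
          mul_div_assoc, ← Real.rpow_sub zero_lt_two, mul_comm]
        push_cast
        ring_nf

theorem carlesonIntensity_stripPart_le {α : ℝ} (β : ℝ) (hα : 1 ≤ α) (μ : Measure ℂ) (n : ℤ) :
    carlesonIntensity α (stripPart μ n) ≤
      (2:ℝ≥0∞) ^ (β + (n : ℝ) * (β - α)) * carlesonIntensity β (stripPart μ n) := by
  refine iSup_le fun a => iSup_le fun b => iSup_le fun hab => ENNReal.div_le_of_le_mul ?_
  rcases lt_or_ge (b - a) ((2:ℝ) ^ n) with hl | hl
  · have hempty : carlesonSquare a b ∩ dyadicStrip n = ∅ :=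
      eq_empty_of_forall_notMem fun z hz => by
        have h₁ := hz.1.2.2
        have h₂ := hz.2.1
        linarith
    rw [stripPart, Measure.restrict_apply' (measurableSet_dyadicStrip n), hempty, measure_empty]
    exact zero_le
  · have hreal := ENNReal.ofReal_le_ofReal (ceil_mul_rpow_le β hα n hl)
    rw [ENNReal.ofReal_mul (by positivity), ENNReal.ofReal_mul (by positivity),
      ENNReal.ofReal_natCast, ← ENNReal.ofReal_rpow_of_pos zero_lt_two,
      ENNReal.ofReal_ofNat] at hreal
    calc stripPart μ n (carlesonSquare a b)
        ≤ _ := stripPart_carlesonSquare_le β μ n hab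
      _ = carlesonIntensity β (stripPart μ n) *
            (⌈(b - a) / (2:ℝ) ^ (n + 1)⌉₊ * ENNReal.ofReal (((2:ℝ) ^ (n + 1)) ^ β)) := by ring
      _ ≤ carlesonIntensity β (stripPart μ n) *
            ((2:ℝ≥0∞) ^ (β + (n : ℝ) * (β - α)) * ENNReal.ofReal ((b - a) ^ α)) := by gcongr
      _ = _ := by ring

/-- for `α, β ≥ 1` and `n ∈ ℤ`,
`𝒞_α[μ_n] ≤ 2^{β+n(β−α)} 𝒞_β[μ_n] ≤ 2^{α+β} 𝒞_α[μ_n]`, so that `𝒞_α[μ_n]` and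
`2^{n(β−α)} 𝒞_β[μ_n]` are comparable with constants depending only on `α` and `β`. -/
theorem carlesonIntensity_compare (α β : ℝ) (hα : 1 ≤ α) (hβ : 1 ≤ β)
    (μ : Measure ℂ) (hμ : μ {z : ℂ | z.re ≤ 0} = 0) (n : ℤ) :
    carlesonIntensity α (stripPart μ n) ≤
      (2:ℝ≥0∞) ^ (β + (n : ℝ) * (β - α)) * carlesonIntensity β (stripPart μ n) ∧
    (2:ℝ≥0∞) ^ (β + (n : ℝ) * (β - α)) * carlesonIntensity β (stripPart μ n) ≤
      (2:ℝ≥0∞) ^ (α + β) * carlesonIntensity α (stripPart μ n) := by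
  refine ⟨carlesonIntensity_stripPart_le β hα μ n, ?_⟩
  calc _ ≤ (2:ℝ≥0∞) ^ (β + (n : ℝ) * (β - α)) *
        ((2:ℝ≥0∞) ^ (α + (n : ℝ) * (α - β)) * carlesonIntensity α (stripPart μ n)) := by
        gcongr
        exact carlesonIntensity_stripPart_le α hβ μ n
    _ = _ := by
        rw [← mul_assoc, ← ENNReal.rpow_add _ _ two_ne_zero ENNReal.ofNat_ne_top]
        ring_nf
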